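/- Let U ⊆ ℝⁿ be an open neighborhood of the origin and let Q : U × ℂᴺ → ℝ be a C² function such that for every x ∈ U the map a ↦ Q(x, a) is a quadratic form on ℂᴺ viewed as a real vector space (i.e., Q(x, a) = B_x(a, a) for some symmetric ℝ-bilinear form B_x on ℂᴺ). Assume: (1) Q(x, ·) is positive semidefinite for every x ∈ U with x_n = 0; (2) (∂Q/∂x_n)(0, a) > 0 for every nonzero a ∈ ℂᴺ with Q(0, a) = 0 (i.e., for every nonzero vector in the null space of the semidefinite form Q(0, ·)). Then there exists a neighborhood V ⊆ U of the origin such that Q(x, ·) is positive definite for every x ∈ V with x_n > 0. -/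

import Mathlib

open Filter Topology in
/-- A function which is nonnegative on the hyperplane `x (Fin.last n) = 0` and whose derivative in
the direction of the last coordinate is positive at `(0, a₀)` is positive at the points near
`(0, a₀)` with positive last coordinate. -/
theorem eventually_pos_of_fderiv_single_last_pos {n : ℕ} {W : Type*} [NormedAddCommGroup W]
    [NormedSpace ℝ W] {F : (Fin (n + 1) → ℝ) × W → ℝ} {a₀ : W}
    (hF : ContDiffAt ℝ 1 F (0, a₀))
    (hnonneg : ∀ᶠ z in 𝓝 ((0 : Fin (n + 1) → ℝ), a₀), z.1 (Fin.last n) = 0 → 0 ≤ F z)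
    (hpos : 0 < fderiv ℝ F (0, a₀) (Pi.single (Fin.last n) 1, 0)) :
    ∀ᶠ z in 𝓝 ((0 : Fin (n + 1) → ℝ), a₀), 0 < z.1 (Fin.last n) → 0 < F z := by
  have hdiff : ∀ᶠ z in 𝓝 ((0 : Fin (n + 1) → ℝ), a₀), DifferentiableAt ℝ F z :=
    (hF.eventually (by simp)).mono fun z hz => hz.differentiableAt one_ne_zero
  have hcont : ContinuousAt (fun z => fderiv ℝ F z (Pi.single (Fin.last n) 1, 0))
      ((0 : Fin (n + 1) → ℝ), a₀) :=
    (hF.continuousAt_fderiv one_ne_zero).clm_apply continuousAt_const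
  obtain ⟨r, hr, hball⟩ := Metric.eventually_nhds_iff_ball.1
    ((hdiff.and hnonneg).and (hcont.eventually (lt_mem_nhds hpos)))
  refine Metric.eventually_nhds_iff_ball.2 ⟨r, hr, ?_⟩
  rintro ⟨x, a⟩ hx hxn
  simp only at hxn
  set y : Fin (n + 1) → ℝ := Function.update x (Fin.last n) 0 with hy
  have hyx : ‖y‖ ≤ ‖x‖ := by
    refine (pi_norm_le_iff_of_nonneg (norm_nonneg x)).2 fun i => ?_
    by_cases hi : i = Fin.last n
    · subst hi; simp [hy]
    · simpa [hy, hi] using norm_le_pi_norm x i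
  have hymem : (y, a) ∈ Metric.ball ((0 : Fin (n + 1) → ℝ), a₀) r := by
    rw [← ball_prod_same, Set.mem_prod, mem_ball_zero_iff] at hx ⊢
    exact ⟨hyx.trans_lt hx.1, hx.2⟩
  obtain ⟨z, hz, hmvt⟩ := domain_mvt
    (fun z hz => (hball z hz).1.1.hasFDerivAt.hasFDerivWithinAt)
    (convex_ball ((0 : Fin (n + 1) → ℝ), a₀) r) hymem hx
  have hz' := (hball z ((convex_ball _ r).segment_subset hymem hx hz)).2
  have hsub : (x, a) - (y, a) =
      x (Fin.last n) • ((Pi.single (Fin.last n) 1, 0) : (Fin (n + 1) → ℝ) × W) := by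
    ext i
    · by_cases hi : i = Fin.last n
      · subst hi; simp [hy]
      · simp [hy, hi]
    · simp
  rw [hsub, map_smul, smul_eq_mul] at hmvt
  have hFy : 0 ≤ F (y, a) := (hball _ hymem).1.2 (by simp [hy])
  nlinarith [mul_pos hxn hz']

/-- Let `U ⊆ ℝ^(n+1)` be a neighborhood of the origin and
`Q : U × ℂᴺ → ℝ` a `C²` function which is a quadratic form in its second variable.
If `Q(x, ·)` is positive semidefinite whenever `x ∈ U` has vanishing last coordinate,
and the partial derivative `∂Q/∂x_n(0, a)` is positive for every nonzero `a` in the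
null space of `Q(0, ·)`, then `Q(x, ·)` is positive definite for all `x` near the
origin with positive last coordinate. -/
theorem posDef_of_semiDef_and_positive_normal_derivative
    {n N : ℕ} (U : Set (Fin (n + 1) → ℝ)) (hU : IsOpen U) (h0 : (0 : Fin (n + 1) → ℝ) ∈ U)
    (Q : (Fin (n + 1) → ℝ) → (Fin N → ℂ) → ℝ)
    (hC2 : ContDiffOn ℝ 2
      (fun z : (Fin (n + 1) → ℝ) × (Fin N → ℂ) => Q z.1 z.2)
      (U ×ˢ (Set.univ : Set (Fin N → ℂ))))
    (hquad : ∀ x ∈ U, ∃ B : (Fin N → ℂ) →ₗ[ℝ] (Fin N → ℂ) →ₗ[ℝ] ℝ,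
      (∀ a b : Fin N → ℂ, B a b = B b a) ∧ ∀ a : Fin N → ℂ, Q x a = B a a)
    (hsemidef : ∀ x ∈ U, x (Fin.last n) = 0 → ∀ a : Fin N → ℂ, 0 ≤ Q x a)
    (hderiv : ∀ a : Fin N → ℂ, a ≠ 0 → Q 0 a = 0 →
      0 < fderiv ℝ (fun x => Q x a) 0 (Pi.single (Fin.last n) 1)) :
    ∃ V : Set (Fin (n + 1) → ℝ), V ⊆ U ∧ IsOpen V ∧ (0 : Fin (n + 1) → ℝ) ∈ V ∧
      ∀ x ∈ V, 0 < x (Fin.last n) → ∀ a : Fin N → ℂ, a ≠ 0 → 0 < Q x a := by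
  have hUU : IsOpen (U ×ˢ (Set.univ : Set (Fin N → ℂ))) := hU.prod isOpen_univ
  have hloc : ∀ a ∈ Metric.sphere (0 : Fin N → ℂ) 1,
      ∀ᶠ z in nhds ((0 : Fin (n + 1) → ℝ), a), 0 < z.1 (Fin.last n) → 0 < Q z.1 z.2 := by
    intro a ha
    have hmem : U ×ˢ (Set.univ : Set (Fin N → ℂ)) ∈ nhds ((0 : Fin (n + 1) → ℝ), a) :=
      hUU.mem_nhds ⟨h0, Set.mem_univ a⟩
    have hF := hC2.contDiffAt hmem
    have ha0 : a ≠ 0 := ne_zero_of_mem_unit_sphere ⟨a, ha⟩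
    rcases (hsemidef 0 h0 rfl a).lt_or_eq with hlt | heq
    · exact (hF.continuousAt.eventually (lt_mem_nhds hlt)).mono fun z hz _ => hz
    · refine eventually_pos_of_fderiv_single_last_pos (hF.of_le one_le_two)
        (Filter.mem_of_superset hmem fun z hz hzn => hsemidef z.1 hz.1 hzn z.2) ?_
      have hcomp := (hF.differentiableAt two_ne_zero).hasFDerivAt.comp
        (0 : Fin (n + 1) → ℝ) (hasFDerivAt_prodMk_left (𝕜 := ℝ) (0 : Fin (n + 1) → ℝ) a)
      have hd := hderiv a ha0 heq.symm
      rw [show (fun x => Q x a) = (fun z : (Fin (n + 1) → ℝ) × (Fin N → ℂ) => Q z.1 z.2) ∘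
        fun x => (x, a) from rfl, hcomp.fderiv] at hd
      simpa using hd
  obtain ⟨V, hV, hVo, hV0⟩ := eventually_nhds_iff.1
    ((isCompact_sphere (0 : Fin N → ℂ) 1).eventually_forall_of_forall_eventually
      (P := fun x a => 0 < x (Fin.last n) → 0 < Q x a) hloc)
  refine ⟨V ∩ U, Set.inter_subset_right, hVo.inter hU, ⟨hV0, h0⟩, fun x hx hxn a ha => ?_⟩
  have hna : 0 < ‖a‖ := norm_pos_iff.2 ha
  obtain ⟨B, -, hB⟩ := hquad x hx.2
  have hunit := hV x hx.1 (‖a‖⁻¹ • a) (by simp [norm_smul, hna.ne']) hxn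
  rw [hB, map_smul, map_smul, LinearMap.smul_apply, smul_eq_mul, smul_eq_mul] at hunit
  rw [hB]
  have hinv := inv_pos.2 hna
  exact (mul_pos_iff_of_pos_left hinv).1 ((mul_pos_iff_of_pos_left hinv).1 hunit)
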